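/- Let E₀ > 0, S > 0, p ∈ (0,1), C > 0, and set R = S/E₀. Then for every real t ≥ 0, the likelihood-ratio inequality ( (1/(π·(S/p + E₀))) · exp(−t/(S/p + E₀)) ) / ( (1/(π·E₀)) · exp(−t/E₀) ) ≥ ((1−p)/p)·C holds if and only if t ≥ E₀·(p/R + 1)·ln( (1 + R/p) · ((1−p)/p) · C ). -/

import Mathlib

open Real

/-- **Appendix A (decision threshold).** The Bayesian likelihood ratio test under the
Bernoulli-complex Gaussian model is equivalent to hard-thresholding the squared magnitude
`t = |h̄'_m|²` at the closed-form threshold `E₀·(p/R + 1)·ln((1 + R/p)·((1−p)/p)·C)`. -/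
theorem likelihood_ratio_threshold
    (E₀ S p C : ℝ) (hE0 : 0 < E₀) (hS : 0 < S) (hp0 : 0 < p) (hp1 : p < 1) (hC : 0 < C)
    (R : ℝ) (hR : R = S / E₀) :
    ∀ t : ℝ, 0 ≤ t →
      (((1 / (π * (S / p + E₀))) * Real.exp (-t / (S / p + E₀))) /
          ((1 / (π * E₀)) * Real.exp (-t / E₀)) ≥ ((1 - p) / p) * C
        ↔ t ≥ E₀ * (p / R + 1) * Real.log ((1 + R / p) * (((1 - p) / p) * C))) := by
  intro t _
  have hK : 0 < (1 - p) / p * C := mul_pos (div_pos (by linarith) hp0) hC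
  generalize (1 - p) / p * C = K at hK ⊢
  have hRpos : 0 < R := hR ▸ div_pos hS hE0
  have hA : 0 < 1 + R / p := by positivity
  have hB : 0 < E₀ * (p / R + 1) := by positivity
  have hD : 0 < S / p + E₀ := by positivity
  have hS' : S = R * E₀ := by rw [hR]; field_simp
  have hexp : Real.exp (-t / (S / p + E₀))
      = Real.exp (t / (E₀ * (p / R + 1))) * Real.exp (-t / E₀) := by
    rw [← Real.exp_add]
    congr 1
    subst hS'
    field_simp
    ring
  have hden : S / p + E₀ = E₀ * (1 + R / p) := by
    rw [hS']; field_simp; ring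
  have hL : ((1 / (π * (S / p + E₀))) * Real.exp (-t / (S / p + E₀))) /
          ((1 / (π * E₀)) * Real.exp (-t / E₀))
      = Real.exp (t / (E₀ * (p / R + 1))) / (1 + R / p) := by
    rw [hexp, hden]
    have h1 := Real.exp_ne_zero (-t / E₀)
    have h2 := Real.pi_ne_zero
    have h3 := hA.ne'
    generalize Real.exp (-t / E₀) = x at *
    generalize Real.exp (t / (E₀ * (p / R + 1))) = y at *
    generalize 1 + R / p = a at *
    field_simp
  rw [hL, ge_iff_le, ge_iff_le, le_div_iff₀ hA, mul_comm K,
    ← Real.log_le_iff_le_exp (mul_pos hA hK), le_div_iff₀ hB, mul_comm (Real.log _)]
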